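/- Let C ∈ (ℝ²)*⊗(ℝ²)*⊗ℝ² satisfy ρ_{s,C} = ε·[[0,1],[1,0]] for some ε ∈ {+1,−1} (nondegenerate null-diagonal symmetric Ricci tensor in normal form). Then for any point P ∈ ℝ⁺×ℝ, any smooth vector field X defined on a connected open neighborhood of P in ℝ⁺×ℝ which satisfies the affine Killing equation for ∇^C is of the form X = α(x¹∂_{x¹} + x²∂_{x²}) + β∂_{x²} for constants α, β ∈ ℝ. (No Type C exception is needed here: the Levi-Civita connection of g₀ = (dx¹⊗dx² + dx²⊗dx¹)/(x¹)² has vanishing Ricci tensor, so it cannot satisfy the hypothesis.) -/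

import Mathlib

open scoped BigOperators
open Matrix

/-- The Ricci matrix `ρ_C` of the Type B connection with Christoffel symbols
`Γ_{ij}{}^k = C_{ij}{}^k/x¹` (evaluated at `x¹ = 1`; indices are 0-based, so
`C 0 0 0 = C₁₁¹`, etc.). -/
noncomputable def rhoC (C : Fin 2 → Fin 2 → Fin 2 → ℝ) : Matrix (Fin 2) (Fin 2) ℝ :=
  !![(C 0 0 0 - C 0 1 1 + 1) * C 1 0 1 + C 0 0 1 * (C 1 1 1 - C 1 0 0),
     C 1 1 1 + C 0 1 0 * C 1 0 1 - C 0 0 1 * C 1 1 0;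
     -C 1 0 0 + C 0 1 0 * C 1 0 1 - C 0 0 1 * C 1 1 0,
     (C 0 0 0 - C 0 1 1 - 1) * C 1 1 0 + C 0 1 0 * (C 1 1 1 - C 1 0 0)]

/-- The symmetric Ricci matrix `ρ_{s,C} = (ρ_C + ρ_Cᵀ)/2`. -/
noncomputable def rhoS (C : Fin 2 → Fin 2 → Fin 2 → ℝ) : Matrix (Fin 2) (Fin 2) ℝ :=
  (1 / 2 : ℝ) • (rhoC C + (rhoC C)ᵀ)
/-- The partial derivative `∂_{x^i} f` of a function on `ℝ²`. -/
noncomputable def pd (i : Fin 2) (f : ℝ × ℝ → ℝ) : ℝ × ℝ → ℝ :=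
  fun p => fderiv ℝ f p (if i = 0 then (1, 0) else (0, 1))

/-- The Christoffel symbols `Γ_{ij}{}^k = C_{ij}{}^k/x¹` of the Type B connection `∇^C`. -/
noncomputable def Gam (C : Fin 2 → Fin 2 → Fin 2 → ℝ) (i j k : Fin 2) : ℝ × ℝ → ℝ :=
  fun p => C i j k / p.1

/-- The affine Killing equation for a vector field `X = X¹∂₁ + X²∂₂` (components
`fun p => X p l`) with respect to the Type B connection `∇^C`, at the point `p`:
`∂_i∂_j X^l + Σ_k (X^k ∂_k Γ_{ij}{}^l + Γ_{kj}{}^l ∂_i X^k + Γ_{ik}{}^l ∂_j X^k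
  − Γ_{ij}{}^k ∂_k X^l) = 0` for all `i j l`. -/
noncomputable def IsAffineKillingAt (C : Fin 2 → Fin 2 → Fin 2 → ℝ)
    (X : ℝ × ℝ → Fin 2 → ℝ) (p : ℝ × ℝ) : Prop :=
  ∀ i j l : Fin 2,
    pd i (pd j fun q => X q l) p
      + ∑ k : Fin 2,
          (X p k * pd k (Gam C i j l) p
            + Gam C k j l p * pd i (fun q => X q k) p
            + Gam C i k l p * pd j (fun q => X q k) p
            - Gam C i j k p * pd k (fun q => X q l) p) = 0

/-- The first-order part of the affine Killing operator, multiplied by `x¹`, as a function of the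
first derivatives `D i k = ∂_i X^k`. -/
def killingFirstOrder (C : Fin 2 → Fin 2 → Fin 2 → ℝ) (D : Fin 2 → Fin 2 → ℝ) (i j l : Fin 2) : ℝ :=
  ∑ k : Fin 2, (C k j l * D i k + C i k l * D j k - C i j k * D k l)

/-- The Ricci matrix as the trace of the curvature tensor. -/
lemma rhoC_apply (C : Fin 2 → Fin 2 → Fin 2 → ℝ) (i j : Fin 2) :
    rhoC C i j = -C i j 0 + (if i = 0 then 1 else 0) * ∑ l : Fin 2, C l j l
      + ∑ l : Fin 2, ∑ b : Fin 2, (C l b l * C i j b - C i b l * C l j b) := by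
  fin_cases i <;> fin_cases j <;> simp [rhoC, Fin.sum_univ_two] <;> ring

/-- Jet form of the invariance of the Ricci tensor: the 3-jet `(a, D, H, T)` of a vector field that
solves the affine Killing equation and its first derivatives annihilates the Ricci tensor. -/
lemma lie_rhoC_eq_zero (C : Fin 2 → Fin 2 → Fin 2 → ℝ) (x a : ℝ) (D : Fin 2 → Fin 2 → ℝ)
    (H : Fin 2 → Fin 2 → Fin 2 → ℝ) (T : Fin 2 → Fin 2 → Fin 2 → Fin 2 → ℝ)
    (hH : ∀ i j l, H i j l = H j i l) (hT : ∀ m i j l, T m i j l = T i m j l)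
    (hF : ∀ i j l, x ^ 2 * H i j l - C i j l * a + x * killingFirstOrder C D i j l = 0)
    (hG : ∀ m i j l,
      (if m = 0 then 1 else 0) * (2 * x * H i j l + killingFirstOrder C D i j l)
        + x ^ 2 * T m i j l - C i j l * D m 0
        + x * killingFirstOrder C (H m) i j l = 0)
    (i j : Fin 2) :
    -2 * a * rhoC C i j + x * ∑ k : Fin 2, (rhoC C k j * D i k + rhoC C i k * D j k) = 0 := by
  simp only [killingFirstOrder, Fin.sum_univ_two] at hF hG
  have g0 := hG 0 i j 0
  have g1 := hG 1 i j 1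
  have g2 := hG i 0 j 0
  have g3 := hG i 1 j 1
  simp only [one_ne_zero, if_true, if_false] at g0 g1
  simp only [rhoC_apply, Fin.sum_univ_two, one_ne_zero, if_true, if_false]
  linear_combination x * (g0 + g1 - g2 - g3) - x ^ 3 * (hT 0 i j 0 + hT 1 i j 1)
    - 2 * hF i j 0 + 2 * (if i = 0 then 1 else 0) * (hF 0 j 0 + hF 1 j 1)
    + (C i j 0 * hF 0 0 0 + C 0 0 0 * hF i j 0 - C 0 j 0 * hF i 0 0 - C i 0 0 * hF 0 j 0)
    + (C i j 1 * hF 0 1 0 + C 0 1 0 * hF i j 1 - C 0 j 1 * hF i 1 0 - C i 1 0 * hF 0 j 1)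
    + (C i j 0 * hF 1 0 1 + C 1 0 1 * hF i j 0 - C 1 j 0 * hF i 0 1 - C i 0 1 * hF 1 j 0)
    + (C i j 1 * hF 1 1 1 + C 1 1 1 * hF i j 1 - C 1 j 1 * hF i 1 1 - C i 1 1 * hF 1 j 1)
    + x ^ 2 * (C 0 j 0 * hH i 0 0 + C 0 j 1 * hH i 1 0 + C 1 j 0 * hH i 0 1 + C 1 j 1 * hH i 1 1)

section PartialDerivatives

variable {U : Set (ℝ × ℝ)} {f g : ℝ × ℝ → ℝ} {p : ℝ × ℝ}

lemma contDiffOn_pd (hU : IsOpen U) (hf : ContDiffOn ℝ (⊤ : ℕ∞) f U) (i : Fin 2) :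
    ContDiffOn ℝ (⊤ : ℕ∞) (pd i f) U :=
  (hf.fderiv_of_isOpen hU (by simp)).clm_apply contDiffOn_const

lemma pd_congr_of_isOpen (hU : IsOpen U) (h : ∀ q ∈ U, f q = g q) (hp : p ∈ U) (i : Fin 2) :
    pd i f p = pd i g p := by
  have : f =ᶠ[nhds p] g := Filter.eventually_of_mem (hU.mem_nhds hp) h
  rw [pd, this.fderiv_eq, pd]

lemma pd_const (i : Fin 2) (c : ℝ) : pd i (fun _ => c) p = 0 := by
  simp [pd]

lemma pd_fst (i : Fin 2) : pd i (fun q => q.1) p = if i = 0 then 1 else 0 := by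
  have : fderiv ℝ (fun q : ℝ × ℝ => q.1) p = ContinuousLinearMap.fst ℝ ℝ ℝ := fderiv_fst
  fin_cases i <;> simp [pd, this]

lemma pd_add (hf : DifferentiableAt ℝ f p) (hg : DifferentiableAt ℝ g p) (i : Fin 2) :
    pd i (fun q => f q + g q) p = pd i f p + pd i g p := by
  simp [pd, fderiv_fun_add hf hg]

lemma pd_sub (hf : DifferentiableAt ℝ f p) (hg : DifferentiableAt ℝ g p) (i : Fin 2) :
    pd i (fun q => f q - g q) p = pd i f p - pd i g p := by
  simp [pd, fderiv_fun_sub hf hg]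

lemma pd_mul (hf : DifferentiableAt ℝ f p) (hg : DifferentiableAt ℝ g p) (i : Fin 2) :
    pd i (fun q => f q * g q) p = f p * pd i g p + g p * pd i f p := by
  simp [pd, fderiv_fun_mul hf hg]

lemma pd_const_mul (hf : DifferentiableAt ℝ f p) (c : ℝ) (i : Fin 2) :
    pd i (fun q => c * f q) p = c * pd i f p := by
  simp [pd, fderiv_const_mul hf]

lemma pd_comm (hU : IsOpen U) (hf : ContDiffOn ℝ (⊤ : ℕ∞) f U) (hp : p ∈ U) (i j : Fin 2) :
    pd i (pd j f) p = pd j (pd i f) p := by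
  have hc : ContDiffAt ℝ (⊤ : ℕ∞) f p := hf.contDiffAt (hU.mem_nhds hp)
  have hd : DifferentiableAt ℝ (fderiv ℝ f) p :=
    (hc.fderiv_right (m := 1) (by norm_cast)).differentiableAt (by simp)
  have hs : IsSymmSndFDerivAt ℝ f p := hc.isSymmSndFDerivAt (by
    simpa using (by norm_cast : ((2 : ℕ∞) : WithTop ℕ∞) ≤ ((⊤ : ℕ∞) : WithTop ℕ∞)))
  have key : ∀ v w : ℝ × ℝ,
      fderiv ℝ (fun q => fderiv ℝ f q v) p w = fderiv ℝ (fderiv ℝ f) p w v := by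
    intro v w
    rw [fderiv_clm_apply hd (differentiableAt_const v)]
    simp
  unfold pd
  rw [key, key]
  exact hs _ _

lemma eq_const_of_pd_eq_zero (hU : IsOpen U) (hc : IsConnected U)
    (hf : ContDiffOn ℝ (⊤ : ℕ∞) f U) (h : ∀ i, ∀ q ∈ U, pd i f q = 0) :
    ∃ c, ∀ q ∈ U, f q = c := by
  refine hU.exists_is_const_of_fderiv_eq_zero hc.isPreconnected
    (hf.differentiableOn (by simp)) fun q hq => ?_
  have h0 := h 0 q hq
  have h1 := h 1 q hq
  simp only [pd, if_true, one_ne_zero, if_false] at h0 h1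
  ext <;> simp [h0, h1]

end PartialDerivatives

lemma pd_Gam (C : Fin 2 → Fin 2 → Fin 2 → ℝ) (m i j k : Fin 2) {p : ℝ × ℝ} (hp : 0 < p.1) :
    pd m (Gam C i j k) p = if m = 0 then -C i j k / p.1 ^ 2 else 0 := by
  have h : HasFDerivAt (Gam C i j k)
      (C i j k • (-(p.1 ^ 2)⁻¹) • ContinuousLinearMap.fst ℝ ℝ ℝ) p := by
    have := ((hasDerivAt_inv hp.ne').comp_hasFDerivAt p
      (hasFDerivAt_fst (𝕜 := ℝ) (p := p))).const_mul (C i j k)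
    exact this
  rw [pd, h.fderiv]
  split_ifs <;> simp
  ring

lemma IsAffineKillingAt.mul_fst_sq {C : Fin 2 → Fin 2 → Fin 2 → ℝ} {X : ℝ × ℝ → Fin 2 → ℝ}
    {p : ℝ × ℝ} (h : IsAffineKillingAt C X p) (hp : 0 < p.1) (i j l : Fin 2) :
    p.1 ^ 2 * pd i (pd j fun q => X q l) p - C i j l * X p 0
      + p.1 * killingFirstOrder C (fun i k => pd i (fun q => X q k) p) i j l = 0 := by
  have := h i j l
  simp only [Fin.sum_univ_two, pd_Gam C _ _ _ _ hp, Gam] at this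
  simp only [killingFirstOrder, Fin.sum_univ_two]
  simp only [if_true, one_ne_zero, if_false] at this
  field_simp at this
  linear_combination this

/-- If `ρ_{s,C} = ε·[[0,1],[1,0]]` with `ε = ±1` (nondegenerate null-diagonal normal
form; no Type C exception is needed since the Levi-Civita connection of `g₀` is
Ricci-flat), then every smooth vector field on a connected open neighborhood of a
point of the half-plane `x¹ > 0` satisfying the affine Killing equation for `∇^C`
lies in the 2-dimensional algebra `𝔥`, i.e. has the form `α(x¹∂₁ + x²∂₂) + β∂₂`. -/
theorem killing_fields_null_case (C : Fin 2 → Fin 2 → Fin 2 → ℝ) (eps : ℝ)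
    (heps : eps = 1 ∨ eps = -1) (hrho : rhoS C = eps • !![(0 : ℝ), 1; 1, 0])
    (P : ℝ × ℝ) (hP : 0 < P.1)
    (U : Set (ℝ × ℝ)) (hUo : IsOpen U) (hUc : IsConnected U) (hPU : P ∈ U)
    (hU1 : ∀ p ∈ U, 0 < p.1)
    (X : ℝ × ℝ → Fin 2 → ℝ) (hX : ∀ l : Fin 2, ContDiffOn ℝ (⊤ : ℕ∞) (fun q => X q l) U)
    (hkill : ∀ p ∈ U, IsAffineKillingAt C X p) :
    ∃ α β : ℝ, ∀ p ∈ U, X p 0 = α * p.1 ∧ X p 1 = α * p.2 + β := by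
  have hS := fun i l => contDiffOn_pd hUo (hX l) i
  have hSS := fun i j l => contDiffOn_pd hUo (hS j l) i
  have hd : ∀ {f : ℝ × ℝ → ℝ}, ContDiffOn ℝ (⊤ : ℕ∞) f U → ∀ p ∈ U, DifferentiableAt ℝ f p :=
    fun hf p hp => (hf.contDiffAt (hUo.mem_nhds hp)).differentiableAt (by simp)
  have hF := fun p hp => (hkill p hp).mul_fst_sq (hU1 p hp)
  have hG : ∀ p ∈ U, ∀ m i j l,
      (if m = 0 then 1 else 0) * (2 * p.1 * pd i (pd j fun q => X q l) p
          + killingFirstOrder C (fun i k => pd i (fun q => X q k) p) i j l)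
        + p.1 ^ 2 * pd m (pd i (pd j fun q => X q l)) p - C i j l * pd m (fun q => X q 0) p
        + p.1 * killingFirstOrder C (fun i k => pd m (pd i (fun q => X q k)) p) i j l = 0 := by
    intro p hp m i j l
    have h := pd_congr_of_isOpen hUo (fun q hq => hF q hq i j l) hp m
    have d0 := hd (hX 0) p hp
    have d1 := fun i k => hd (hS i k) p hp
    have d2 := hd (hSS i j l) p hp
    simp only [killingFirstOrder, Fin.sum_univ_two, pow_two] at h ⊢
    simp (disch := fun_prop) only [pd_const, pd_add, pd_sub, pd_const_mul, pd_mul, pd_fst] at h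
    linear_combination h
  have hL : ∀ p ∈ U, ∀ i j : Fin 2,
      -2 * X p 0 * rhoC C i j
        + p.1 * ∑ k : Fin 2, (rhoC C k j * pd i (fun q => X q k) p
          + rhoC C i k * pd j (fun q => X q k) p) = 0 := fun p hp => lie_rhoC_eq_zero C p.1 (X p 0)
    (fun i k => pd i (fun q => X q k) p) (fun i j l => pd i (pd j fun q => X q l) p)
    (fun m i j l => pd m (pd i (pd j fun q => X q l)) p)
    (fun i j l => pd_comm hUo (hX l) hp i j) (fun m i j l => pd_comm hUo (hS j l) hp m i) (hF p hp) (hG p hp)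
  have r00 := congrFun (congrFun hrho 0) 0
  have r01 := congrFun (congrFun hrho 0) 1
  have r11 := congrFun (congrFun hrho 1) 1
  have heps0 : eps ≠ 0 := by rcases heps with rfl | rfl <;> norm_num
  simp only [rhoS, Matrix.smul_apply, Matrix.add_apply, transpose_apply, smul_eq_mul, of_apply, cons_val_zero,
    cons_val_one, mul_zero, mul_one] at r00 r01 r11
  replace r01 : rhoC C 1 0 = 2 * eps - rhoC C 0 1 := by linear_combination 2 * r01
  replace r00 : rhoC C 0 0 = 0 := by linear_combination r00
  replace r11 : rhoC C 1 1 = 0 := by linear_combination r11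
  simp only [Fin.sum_univ_two] at hL
  have hDb : ∀ p ∈ U, pd 0 (fun q => X q 1) p = 0 := by
    intro p hp
    have h := hL p hp 0 0
    have hx := (hU1 p hp).ne'
    rw [r00, r01] at h
    have : (p.1 * (2 * eps)) * pd 0 (fun q => X q 1) p = 0 := by linear_combination h
    simpa [hx, heps0] using this
  have hDa : ∀ p ∈ U, pd 1 (fun q => X q 0) p = 0 := by
    intro p hp
    have h := hL p hp 1 1
    have hx := (hU1 p hp).ne'
    rw [r11, r01] at h
    have : (p.1 * (2 * eps)) * pd 1 (fun q => X q 0) p = 0 := by linear_combination h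
    simpa [hx, heps0] using this
  have htr : ∀ p ∈ U, p.1 * (pd 0 (fun q => X q 0) p + pd 1 (fun q => X q 1) p)
      - 2 * X p 0 = 0 := by
    intro p hp
    have h := hL p hp 0 1
    have h' := hL p hp 1 0
    rw [r00, r11] at h h'
    rw [r01] at h'
    have : (2 * eps) * (p.1 * (pd 0 (fun q => X q 0) p + pd 1 (fun q => X q 1) p)
      - 2 * X p 0) = 0 := by linear_combination h + h'
    simpa [heps0] using this
  have hDDb : ∀ i, ∀ p ∈ U, pd i (pd 0 fun q => X q 1) p = 0 := fun i p hp => by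
    rw [pd_congr_of_isOpen hUo hDb hp, pd_const]
  have hDDa : ∀ i, ∀ p ∈ U, pd i (pd 1 fun q => X q 0) p = 0 := fun i p hp => by
    rw [pd_congr_of_isOpen hUo hDa hp, pd_const]
  have hDtr : ∀ i, ∀ p ∈ U,
      p.1 * (pd i (pd 0 fun q => X q 0) p + pd i (pd 1 fun q => X q 1) p)
        + (pd 0 (fun q => X q 0) p + pd 1 (fun q => X q 1) p) * (if i = 0 then 1 else 0)
        - 2 * pd i (fun q => X q 0) p = 0 := by
    intro i p hp
    have h := pd_congr_of_isOpen hUo htr hp i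
    have d0 := hd (hX 0) p hp
    have d1 := fun i k => hd (hS i k) p hp
    simpa (disch := fun_prop) only [pd_const, pd_add, pd_sub, pd_const_mul, pd_mul, pd_fst] using h
  have hbyx : ∀ p ∈ U, pd 0 (pd 1 fun q => X q 1) p = 0 := fun p hp => by
    rw [pd_comm hUo (hX 1) hp, hDDb 1 p hp]
  have hbyy : ∀ p ∈ U, pd 1 (pd 1 fun q => X q 1) p = 0 := by
    intro p hp
    have h := hDtr 1 p hp
    rw [pd_comm hUo (hX 0) hp, hDDa 0 p hp, hDa p hp] at h
    simpa [(hU1 p hp).ne'] using h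
  obtain ⟨α, hα⟩ := eq_const_of_pd_eq_zero hUo hUc (hS 1 1)
    (Fin.forall_fin_two.2 ⟨hbyx, hbyy⟩)
  have ha : ∀ p ∈ U, X p 0 = α * p.1 := by
    intro p hp
    by_contra hne
    have hk : X p 0 - α * p.1 ≠ 0 := sub_ne_zero.2 hne
    have e0 := htr p hp
    have e1 := hDtr 0 p hp
    have hax : p.1 * pd 0 (fun q => X q 0) p = 2 * X p 0 - α * p.1 := by
      rw [hα p hp] at e0
      linear_combination e0
    have haxx : p.1 ^ 2 * pd 0 (pd 0 fun q => X q 0) p = 2 * (X p 0 - α * p.1) := by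
      rw [hbyx p hp, hα p hp] at e1
      simp only [if_true] at e1
      linear_combination p.1 * e1 + hax
    have hD : ∀ i k, p.1 * pd i (fun q => X q k) p =
        if i = k then α * p.1 + (if k = 0 then 2 * (X p 0 - α * p.1) else 0) else 0 := by
      simp only [Fin.forall_fin_two]
      simp [hDa p hp, hDb p hp, hα p hp, mul_comm α, hax]
      ring
    have hH : ∀ i j l, p.1 ^ 2 * pd i (pd j fun q => X q l) p =
        if i = 0 ∧ j = 0 ∧ l = 0 then 2 * (X p 0 - α * p.1) else 0 := by
      simp only [Fin.forall_fin_two]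
      simp [pd_comm hUo (hX 0) hp 1 0, hDDa _ p hp, hDDb _ p hp, hbyx p hp, hbyy p hp, haxx]
    have hC : ∀ i j l, C i j l = if i = 0 ∧ j = 0 ∧ l = 0 then -2 else 0 := by
      intro i j l
      have h := hF p hp i j l
      simp only [killingFirstOrder, Fin.sum_univ_two] at h
      have key : C i j l * (2 * ((if i = 0 then 1 else 0) + (if j = 0 then 1 else 0)
          - (if l = 0 then 1 else 0)) - 1) + (if i = 0 ∧ j = 0 ∧ l = 0 then 2 else 0) = 0 := by
        refine (mul_eq_zero_iff_left hk).1 ?_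
        linear_combination (norm := skip) h - hH i j l
          - (C 0 j l * hD i 0 + C i 0 l * hD j 0 - C i j 0 * hD 0 l)
          - (C 1 j l * hD i 1 + C i 1 l * hD j 1 - C i j 1 * hD 1 l)
        fin_cases i <;> fin_cases j <;> fin_cases l <;> simp <;> ring
      clear h
      fin_cases i <;> fin_cases j <;> fin_cases l <;> norm_num at key ⊢ <;> linarith
    apply heps0
    have h1 : rhoC C 0 1 = 0 := by simp [rhoC, hC]
    have h2 : rhoC C 1 0 = 0 := by simp [rhoC, hC]
    linarith
  obtain ⟨β, hβ⟩ := eq_const_of_pd_eq_zero (f := fun q => X q 1 - α * q.2) hUo hUc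
    ((hX 1).sub (contDiff_const.mul contDiff_snd).contDiffOn) (by
      intro i q hq
      have hs : pd i (fun q => q.2) q = if i = 0 then 0 else 1 := by
        have : fderiv ℝ (fun q : ℝ × ℝ => q.2) q = ContinuousLinearMap.snd ℝ ℝ ℝ := fderiv_snd
        fin_cases i <;> simp [pd, this]
      have d1 := hd (hX 1) q hq
      simp (disch := fun_prop) only [pd_sub, pd_const_mul, hs]
      fin_cases i
      · simp [hDb q hq]
      · simp [hα q hq])
  exact ⟨α, β, fun p hp => ⟨ha p hp, by linear_combination hβ p hp⟩⟩
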